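/- Let μ ≥ 1 be a natural number, A an open subset of ℝ^α, and U(x,y,a) a real-analytic function on [-1,1]² × A with U(0,0,a) > 0 for every a ∈ A. Define T₀(s;ε,a) := ∫_{s+ϑ_ε}^{1} U(x,0,a)/(x^μ - ε) dx for s > 0 small and ε near 0. Then (i) ∂_s T₀(s;ε,a) = - U(s+ϑ_ε, 0, a) / ((s+ϑ_ε)^μ - ε), and (ii) ∂_s T₀(s;ε,a) → -∞ as (s,ε) → (0⁺, 0), uniformly with respect to a on every compact subset of A. -/

import Mathlib

open Set MeasureTheory

/-- `ϑ_ε`: the largest real root of `x (x^μ - ε)`, namely `0` if `ε ≤ 0` and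
`ε^(1/μ)` if `ε ≥ 0`. -/
noncomputable def theta (μ : ℕ) (ε : ℝ) : ℝ := if ε ≤ 0 then 0 else ε ^ ((μ : ℝ)⁻¹)

open Set MeasureTheory Filter Topology

lemma theta_nonneg (μ : ℕ) (ε : ℝ) : 0 ≤ theta μ ε := by
  unfold theta
  split_ifs with h
  · exact le_rfl
  · exact Real.rpow_nonneg (not_le.mp h).le _

lemma le_theta_pow {μ : ℕ} (hμ : 1 ≤ μ) (ε : ℝ) : ε ≤ theta μ ε ^ μ := by
  unfold theta
  split_ifs with h
  · exact h.trans (by positivity)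
  · rw [Real.rpow_inv_natCast_pow (not_le.mp h).le (by lia)]

lemma theta_lt {μ : ℕ} (hμ : 1 ≤ μ) {ε η : ℝ} (hη : 0 < η) (h : ε < η ^ μ) :
    theta μ ε < η := by
  unfold theta
  split_ifs with h0
  · exact hη
  · refine lt_of_pow_lt_pow_left₀ μ hη.le ?_
    rwa [Real.rpow_inv_natCast_pow (not_le.mp h0).le (by lia)]

lemma pow_sub_pos_of_theta_lt {μ : ℕ} (hμ : 1 ≤ μ) {ε x : ℝ} (h : theta μ ε < x) :
    0 < x ^ μ - ε :=
  sub_pos.mpr ((le_theta_pow hμ ε).trans_lt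
    (pow_lt_pow_left₀ h (theta_nonneg μ ε) (by lia)))

lemma hasDerivAt_integral_div_pow_sub {μ : ℕ} (hμ : 1 ≤ μ) {f : ℝ → ℝ}
    (hf : ContinuousOn f (Icc 0 1)) {s ε : ℝ} (hs : 0 < s) (hs1 : s + theta μ ε < 1) :
    HasDerivAt (fun s' => ∫ x in (s' + theta μ ε)..1, f x / (x ^ μ - ε))
      (-(f (s + theta μ ε) / ((s + theta μ ε) ^ μ - ε))) s := by
  have hθ := theta_nonneg μ ε
  have hcont : ContinuousOn (fun x => f x / (x ^ μ - ε)) (Ioc (theta μ ε) 1) :=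
    (hf.mono fun x hx => ⟨hθ.trans hx.1.le, hx.2⟩).div (by fun_prop)
      fun x hx => (pow_sub_pos_of_theta_lt hμ hx.1).ne'
  have hcont' := hcont.mono Ioo_subset_Ioc_self
  have hmem : s + theta μ ε ∈ Ioo (theta μ ε) 1 := ⟨by linarith, hs1⟩
  refine HasDerivAt.comp_add_const s (theta μ ε)
    (intervalIntegral.integral_hasDerivAt_left (ContinuousOn.intervalIntegrable ?_)
      (hcont'.stronglyMeasurableAtFilter isOpen_Ioo _ hmem)
      (hcont'.continuousAt (isOpen_Ioo.mem_nhds hmem)))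
  rw [uIcc_of_le hs1.le]
  exact hcont.mono fun x hx => ⟨hmem.1.trans_le hx.1, hx.2⟩

lemma exists_pos_eventually_forall_lt {X Y : Type*} [TopologicalSpace X] [TopologicalSpace Y]
    {K : Set Y} (hK : IsCompact K) {g : X → Y → ℝ} {x₀ : X}
    (hg : ∀ a ∈ K, ContinuousAt (fun p : X × Y => g p.1 p.2) (x₀, a))
    (hpos : ∀ a ∈ K, 0 < g x₀ a) :
    ∃ c > 0, ∀ᶠ x in 𝓝 x₀, ∀ a ∈ K, c < g x a := by
  obtain ⟨c, hc, hcK⟩ : ∃ c > 0, ∀ a ∈ K, c < g x₀ a :=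
    let ⟨c, hc, hcK⟩ := hK.exists_forall_le' (fun a ha => ((hg a ha).comp
      (f := fun b => (x₀, b)) (by fun_prop)).continuousWithinAt) hpos
    ⟨c / 2, half_pos hc, fun a ha => (half_lt_self hc).trans_le (hcK a ha)⟩
  refine ⟨c, hc, hK.eventually_forall_of_forall_eventually fun a ha => ?_⟩
  exact (hg a ha).eventually_const_lt (hcK a ha)

/-- For `T₀(s; ε, a) := ∫_{s+ϑ_ε}^{1} U(x,0,a)/(x^μ - ε) dx` one has
(i) `∂_s T₀(s;ε,a) = -U(s+ϑ_ε,0,a)/((s+ϑ_ε)^μ - ε)` for `s > 0` small and `ε` near `0`, and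
(ii) `∂_s T₀(s;ε,a) → -∞` as `(s,ε) → (0⁺,0)`, uniformly on compact subsets of `A`. -/
theorem deriv_T0_eq_and_tendsto_neg_infty
    {α : ℕ} (μ : ℕ) (hμ : 1 ≤ μ)
    (A : Set (Fin α → ℝ)) (hA : IsOpen A)
    (U : ℝ → ℝ → (Fin α → ℝ) → ℝ)
    (hUan : AnalyticOnNhd ℝ (fun p : ℝ × ℝ × (Fin α → ℝ) => U p.1 p.2.1 p.2.2)
      ((Set.Icc (-1 : ℝ) 1) ×ˢ (Set.Icc (-1 : ℝ) 1) ×ˢ A))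
    (hU0 : ∀ a ∈ A, 0 < U 0 0 a)
    (T₀ : ℝ → ℝ → (Fin α → ℝ) → ℝ)
    (hT₀ : ∀ (s ε : ℝ) (a : Fin α → ℝ),
      T₀ s ε a = ∫ x in (s + theta μ ε)..1, U x 0 a / (x ^ μ - ε)) :
    (∃ s₁ > (0 : ℝ), ∃ ε₁ > (0 : ℝ), ∀ s ε : ℝ, ∀ a ∈ A, 0 < s → s < s₁ → |ε| < ε₁ →
      HasDerivAt (fun s' => T₀ s' ε a)
        (-(U (s + theta μ ε) 0 a / ((s + theta μ ε) ^ μ - ε))) s) ∧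
    (∀ K ⊆ A, IsCompact K → ∀ M > 0, ∃ δ > 0, ∀ s ε : ℝ, ∀ a ∈ K,
      0 < s → s < δ → |ε| < δ → deriv (fun s' => T₀ s' ε a) s < -M) := by
  have hderiv : ∀ s ε : ℝ, ∀ a ∈ A, 0 < s → s < 1 / 2 → |ε| < (1 / 2) ^ μ →
      HasDerivAt (fun s' => T₀ s' ε a)
        (-(U (s + theta μ ε) 0 a / ((s + theta μ ε) ^ μ - ε))) s := by
    intro s ε a ha hs hs1 hε
    have hθ := theta_lt hμ (by norm_num) (lt_of_abs_lt hε)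
    simp only [hT₀]
    refine hasDerivAt_integral_div_pow_sub (f := fun x => U x 0 a) hμ ?_ hs (by linarith)
    exact hUan.continuousOn.comp (f := fun x : ℝ => (x, (0 : ℝ), a)) (by fun_prop)
      fun x hx => ⟨⟨by linarith [hx.1], hx.2⟩, ⟨by norm_num, by norm_num⟩, ha⟩
  refine ⟨⟨1 / 2, by norm_num, (1 / 2) ^ μ, by positivity, hderiv⟩, ?_⟩
  intro K hKA hK M hM
  obtain ⟨c, hc, hev⟩ := exists_pos_eventually_forall_lt (g := fun x a => U x 0 a) (x₀ := 0) hK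
    (fun a ha => ContinuousAt.comp (x := ((0 : ℝ), a))
      (f := fun p : ℝ × (Fin α → ℝ) => (p.1, (0 : ℝ), p.2))
      (g := fun p : ℝ × ℝ × (Fin α → ℝ) => U p.1 p.2.1 p.2.2)
      (hUan (0, 0, a) ⟨by simp, by simp, hKA ha⟩).continuousAt (by fun_prop))
    fun a ha => hU0 a (hKA ha)
  obtain ⟨ρ, hρ, hball⟩ := Metric.eventually_nhds_iff.mp hev
  obtain ⟨r, hr, hrmin⟩ := exists_between
    (show 0 < min (min 1 ρ) (c / (2 * M)) by positivity)
  simp only [lt_min_iff] at hrmin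
  obtain ⟨⟨hr1, hrρ⟩, hrc⟩ := hrmin
  have hrc' : r * (2 * M) < c := (lt_div_iff₀ (by positivity)).mp hrc
  refine ⟨min (r / 2) ((r / 2) ^ μ), by positivity, fun s ε a ha hs hsδ hεδ => ?_⟩
  rw [lt_min_iff] at hsδ hεδ
  rw [(hderiv s ε a (hKA ha) hs (by linarith [hsδ.1])
    (hεδ.2.trans_le (by gcongr))).deriv]
  have hθ0 := theta_nonneg μ ε
  have hθ := theta_lt hμ (half_pos hr) (lt_of_abs_lt hεδ.2)
  have hD : 0 < (s + theta μ ε) ^ μ - ε := pow_sub_pos_of_theta_lt hμ (by linarith)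
  have hU : c < U (s + theta μ ε) 0 a := by
    refine hball ?_ a ha
    rw [Real.dist_eq, sub_zero, abs_of_nonneg (by linarith)]
    linarith [hsδ.1]
  have hpow : (s + theta μ ε) ^ μ ≤ s + theta μ ε :=
    pow_le_of_le_one (by linarith) (by linarith [hsδ.1]) (by lia)
  have hD2 : (s + theta μ ε) ^ μ - ε < 2 * r := by
    linarith [hsδ.1, hεδ.1, neg_abs_le ε]
  rw [neg_lt_neg_iff, lt_div_iff₀ hD]
  nlinarith [mul_lt_mul_of_pos_left hD2 hM]
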